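/- arXiv:1610.01555 — 2 statements merged into one kernel-verified Lean document; each statement's English description precedes it below -/
import Mathlib

section
/- The set of vertices 𝒱 = {V₁,…,V_{n+2}} of a strip of triangles △̄ is poised for S(△̄): for every function c : 𝒱 → ℝ there is a unique s ∈ S(△̄) with s(Vᵢ) = c(Vᵢ) for all i = 1,…,n+2. -/
open scoped Classical

noncomputable section

/-- Points of the plane. -/
abbrev E : Type := ℝ × ℝ

/-- The closed triangle `Δᵢ` with vertices `V i`, `V (i+1)`, `V (i+2)`. -/
def tri (V : ℕ → E) (i : ℕ) : Set E :=
  convexHull ℝ {V i, V (i + 1), V (i + 2)}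

/-- `V 1, …, V (n+2)` are the vertices of a strip of `n` triangles
`Δ₁, …, Δₙ`, where `Δᵢ = [Vᵢ, Vᵢ₊₁, Vᵢ₊₂]`. -/
structure IsStrip (n : ℕ) (V : ℕ → E) : Prop where
  indep : ∀ i, 1 ≤ i → i ≤ n → AffineIndependent ℝ ![V i, V (i + 1), V (i + 2)]
  adj : ∀ i, 1 ≤ i → i + 1 ≤ n →
    tri V i ∩ tri V (i + 1) = segment ℝ (V (i + 1)) (V (i + 2))
  touch : ∀ i, 1 ≤ i → i + 2 ≤ n → tri V i ∩ tri V (i + 2) = {V (i + 2)}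
  disj : ∀ i j, 1 ≤ i → j ≤ n → i + 3 ≤ j → tri V i ∩ tri V j = ∅

/-- The underlying set `|△̄ₖᵐ|` of the (sub)strip consisting of the triangles
`Δ k, …, Δ m`. -/
def stripSet (V : ℕ → E) (k m : ℕ) : Set E :=
  ⋃ i ∈ Finset.Icc k m, tri V i

/-- The space `S(△̄ₖᵐ)` of continuous functions on the strip `|△̄ₖᵐ|` whose
restriction to each triangle `Δᵢ`, `k ≤ i ≤ m`, agrees with an affine
function `ℝ² → ℝ`. -/
def stripSpace (V : ℕ → E) (k m : ℕ) : Submodule ℝ (stripSet V k m → ℝ) where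
  carrier := {s | Continuous s ∧ ∀ i ∈ Finset.Icc k m, ∃ f : E →ᵃ[ℝ] ℝ,
    ∀ x : stripSet V k m, (x : E) ∈ tri V i → s x = f x}
  add_mem' := by
    rintro a b ⟨hca, ha⟩ ⟨hcb, hb⟩
    refine ⟨hca.add hcb, fun i hi => ?_⟩
    obtain ⟨f, hf⟩ := ha i hi
    obtain ⟨g, hg⟩ := hb i hi
    exact ⟨f + g, fun x hx => by simp [hf x hx, hg x hx]⟩
  zero_mem' := ⟨continuous_const, fun i hi => ⟨0, fun x hx => by simp⟩⟩
  smul_mem' := by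
    rintro c a ⟨hca, ha⟩
    refine ⟨hca.const_smul c, fun i hi => ?_⟩
    obtain ⟨f, hf⟩ := ha i hi
    exact ⟨c • f, fun x hx => by simp [hf x hx]⟩

/-- Poisedness of a node set `A` for a subspace `T` of the functions on the
strip `|△̄ₖᵐ|`: for every data `c` there is a unique `s ∈ T` interpolating
`c` at the nodes. -/
def PoisedFor (V : ℕ → E) (k m : ℕ) (T : Submodule ℝ (stripSet V k m → ℝ))
    (A : Finset E) : Prop :=
  ∀ c : E → ℝ, ∃! s : stripSet V k m → ℝ,
    s ∈ T ∧ ∀ a : stripSet V k m, (a : E) ∈ A → s a = c a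

/-- Poisedness of the interpolation problem `{△̄ₖᵐ, A}`. -/
def Poised (V : ℕ → E) (k m : ℕ) (A : Finset E) : Prop :=
  PoisedFor V k m (stripSpace V k m) A

/-- The node set `Aₖᵐ = A ∩ |△̄ₖᵐ|` of the subproblem `{△̄, A}ₖᵐ`. -/
def nodesIn (V : ℕ → E) (k m : ℕ) (A : Finset E) : Finset E :=
  A.filter (fun x => x ∈ stripSet V k m)

/-- The nodes of `A` lying in the triangle `Δᵢ`. -/
def triNodes (V : ℕ → E) (i : ℕ) (A : Finset E) : Finset E :=
  A.filter (fun x => x ∈ tri V i)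

/-- Affine functions that agree on a set agree on its convex hull. -/
theorem AffineMap.eqOn_convexHull {f g : E →ᵃ[ℝ] ℝ} {S : Set E} (h : Set.EqOn f g S) :
    Set.EqOn f g (convexHull ℝ S) := by
  have hc : Convex ℝ {x | f x = g x} := by
    have : {x | f x = g x} = (f - g) ⁻¹' {0} := by
      ext x
      simp [sub_eq_zero]
    rw [this]
    exact (convex_singleton 0).affine_preimage _
  exact convexHull_min h hc

/-- An affine function on the plane can be prescribed on three affinely independent points. -/
theorem exists_affineMap_interpolating (p : Fin 3 → E) (hp : AffineIndependent ℝ p)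
    (c : E → ℝ) : ∃ f : E →ᵃ[ℝ] ℝ, ∀ i, f (p i) = c (p i) := by
  have ht : affineSpan ℝ (Set.range p) = ⊤ := by
    rw [hp.affineSpan_eq_top_iff_card_eq_finrank_add_one]
    simp
  let b : AffineBasis (Fin 3) ℝ E := ⟨p, hp, ht⟩
  refine ⟨∑ j, c (p j) • b.coord j, fun i => ?_⟩
  have hb : ∀ j, b.coord j (p i) = if j = i then 1 else 0 := fun j => b.coord_apply j i
  have hs : ∀ (s : Finset (Fin 3)) (x : E),
      (∑ j ∈ s, c (p j) • b.coord j) x = ∑ j ∈ s, c (p j) * b.coord j x := by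
    intro s x
    induction s using Finset.induction_on with
    | empty => simp
    | insert a s ha ih => simp [Finset.sum_insert ha, ih]
  rw [hs]
  simp [hb]

theorem isClosed_tri (V : ℕ → E) (i : ℕ) : IsClosed (tri V i) :=
  Set.Finite.isClosed_convexHull ℝ (by simp)

theorem vertex_mem_tri (V : ℕ → E) {i j : ℕ} (h₁ : i ≤ j) (h₂ : j ≤ i + 2) :
    V j ∈ tri V i := by
  apply subset_convexHull
  obtain rfl | rfl | rfl : j = i ∨ j = i + 1 ∨ j = i + 2 := by omega
  all_goals simp

theorem tri_subset_stripSet (V : ℕ → E) {k m i : ℕ} (hi : i ∈ Finset.Icc k m) :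
    tri V i ⊆ stripSet V k m :=
  Set.subset_biUnion_of_mem (u := fun i => tri V i) hi

/-- Affine pieces interpolating the same data at the vertices agree wherever two triangles
of the strip meet. -/
theorem IsStrip.eq_of_mem_tri {n : ℕ} {V : ℕ → E} (hV : IsStrip n V) {c : E → ℝ}
    {f : ℕ → E →ᵃ[ℝ] ℝ}
    (hf : ∀ i ∈ Finset.Icc 1 n, ∀ j, i ≤ j → j ≤ i + 2 → f i (V j) = c (V j))
    {i j : ℕ} (hi : i ∈ Finset.Icc 1 n) (hj : j ∈ Finset.Icc 1 n) {x : E}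
    (hxi : x ∈ tri V i) (hxj : x ∈ tri V j) : f i x = f j x := by
  wlog hij : i ≤ j generalizing i j
  · exact (this hj hi hxj hxi (le_of_not_ge hij)).symm
  have hi' := Finset.mem_Icc.1 hi
  have hj' := Finset.mem_Icc.1 hj
  obtain rfl | rfl | rfl | h : j = i ∨ j = i + 1 ∨ j = i + 2 ∨ i + 3 ≤ j := by omega
  · rfl
  · have hx : x ∈ tri V i ∩ tri V (i + 1) := ⟨hxi, hxj⟩
    rw [hV.adj i hi'.1 hj'.2, ← convexHull_pair] at hx
    refine AffineMap.eqOn_convexHull ?_ hx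
    rintro y (rfl | rfl)
    · rw [hf i hi _ (by omega) (by omega), hf _ hj _ (by omega) (by omega)]
    · rw [hf i hi _ (by omega) (by omega), hf _ hj _ (by omega) (by omega)]
  · have hx : x ∈ tri V i ∩ tri V (i + 2) := ⟨hxi, hxj⟩
    rw [hV.touch i hi'.1 hj'.2] at hx
    obtain rfl := hx
    rw [hf i hi _ (by omega) (by omega), hf _ hj _ (by omega) (by omega)]
  · have hx : x ∈ tri V i ∩ tri V j := ⟨hxi, hxj⟩
    rw [hV.disj i j hi'.1 hj'.2 h] at hx
    exact hx.elim

/-- A function on the strip that is affine on each triangle is continuous. -/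
theorem continuous_of_affine_on_tri {V : ℕ → E} {k m : ℕ} {s : stripSet V k m → ℝ}
    (hs : ∀ i ∈ Finset.Icc k m, ∃ f : E →ᵃ[ℝ] ℝ,
      ∀ x : stripSet V k m, (x : E) ∈ tri V i → s x = f x) : Continuous s := by
  let t : Finset.Icc k m → Set (stripSet V k m) := fun i => Subtype.val ⁻¹' tri V i
  refine (locallyFinite_of_finite t).continuous ?_
    (fun i => (isClosed_tri V i).preimage continuous_subtype_val) fun i => ?_
  · rw [Set.eq_univ_iff_forall]
    intro x
    obtain ⟨i, hi, hx⟩ := Set.mem_iUnion₂.1 x.2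
    exact Set.mem_iUnion.2 ⟨⟨i, hi⟩, hx⟩
  · obtain ⟨f, hf⟩ := hs i i.2
    exact (f.continuous_of_finiteDimensional.comp continuous_subtype_val).continuousOn.congr
      fun x hx => hf x hx

/-- Two elements of the spline space with the same values at the vertices are equal. -/
theorem eq_of_mem_stripSpace {V : ℕ → E} {k m : ℕ} {s t : stripSet V k m → ℝ}
    (hs : s ∈ stripSpace V k m) (ht : t ∈ stripSpace V k m)
    (h : ∀ a : stripSet V k m, (a : E) ∈ (Finset.Icc k (m + 2)).image V → s a = t a) :
    s = t := by
  ext x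
  obtain ⟨i, hi, hx⟩ := Set.mem_iUnion₂.1 x.2
  obtain ⟨f, hf⟩ := hs.2 i hi
  obtain ⟨g, hg⟩ := ht.2 i hi
  have hv : ∀ j, i ≤ j → j ≤ i + 2 → f (V j) = g (V j) := by
    intro j h₁ h₂
    have hm := vertex_mem_tri V h₁ h₂
    have hi' := Finset.mem_Icc.1 hi
    let a : stripSet V k m := ⟨V j, tri_subset_stripSet V hi hm⟩
    rw [← hf a hm, ← hg a hm]
    exact h a (Finset.mem_image_of_mem V (Finset.mem_Icc.2 ⟨by omega, by omega⟩))
  rw [hf x hx, hg x hx]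
  refine AffineMap.eqOn_convexHull ?_ hx
  rintro y (rfl | rfl | rfl) <;> exact hv _ (by omega) (by omega)

/-- The set of vertices `𝒱 = {V₁, …, V_{n+2}}` of a strip of
triangles `△̄` is poised for `S(△̄)`. -/
theorem vertices_poised (n : ℕ) (hn : 1 ≤ n) (V : ℕ → E) (hV : IsStrip n V) :
    Poised V 1 n ((Finset.Icc 1 (n + 2)).image V) := by
  intro c
  have hex : ∀ i, ∃ f : E →ᵃ[ℝ] ℝ,
      i ∈ Finset.Icc 1 n → ∀ j, i ≤ j → j ≤ i + 2 → f (V j) = c (V j) := by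
    intro i
    by_cases hi : i ∈ Finset.Icc 1 n
    · have hi' := Finset.mem_Icc.1 hi
      obtain ⟨f, hf⟩ := exists_affineMap_interpolating _ (hV.indep i hi'.1 hi'.2) c
      refine ⟨f, fun _ j h₁ h₂ => ?_⟩
      obtain rfl | rfl | rfl : j = i ∨ j = i + 1 ∨ j = i + 2 := by omega
      · exact hf 0
      · exact hf 1
      · exact hf 2
    · exact ⟨0, fun h => absurd h hi⟩
  choose f hf using hex
  have hcover : ∀ x : stripSet V 1 n, ∃ i ∈ Finset.Icc 1 n, (x : E) ∈ tri V i := fun x => by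
    obtain ⟨i, hi, hx⟩ := Set.mem_iUnion₂.1 x.2
    exact ⟨i, hi, hx⟩
  choose idx hidx hmem using hcover
  let s : stripSet V 1 n → ℝ := fun x => f (idx x) x
  have hs : ∀ i ∈ Finset.Icc 1 n, ∀ x : stripSet V 1 n, (x : E) ∈ tri V i → s x = f i x :=
    fun i hi x hx => hV.eq_of_mem_tri hf (hidx x) hi (hmem x) hx
  have haff : ∀ i ∈ Finset.Icc 1 n, ∃ f : E →ᵃ[ℝ] ℝ,
      ∀ x : stripSet V 1 n, (x : E) ∈ tri V i → s x = f x := fun i hi => ⟨f i, hs i hi⟩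
  have hsS : s ∈ stripSpace V 1 n := ⟨continuous_of_affine_on_tri haff, haff⟩
  have hsc : ∀ a : stripSet V 1 n, (a : E) ∈ (Finset.Icc 1 (n + 2)).image V → s a = c a := by
    intro a ha
    obtain ⟨j, hj, hja⟩ := Finset.mem_image.1 ha
    have hj' := Finset.mem_Icc.1 hj
    obtain ⟨i, hi, h₁, h₂⟩ : ∃ i ∈ Finset.Icc 1 n, i ≤ j ∧ j ≤ i + 2 := by
      refine ⟨max 1 (j - 2), Finset.mem_Icc.2 ⟨?_, ?_⟩, ?_, ?_⟩ <;> omega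
    rw [hs i hi a (hja ▸ vertex_mem_tri V h₁ h₂), ← hja]
    exact hf i hi j h₁ h₂
  refine ⟨s, ⟨hsS, hsc⟩, fun t ⟨htS, htc⟩ => ?_⟩
  exact eq_of_mem_stripSpace htS hsS fun a ha => (htc a ha).trans (hsc a ha).symm
end
end

section
/- Let {△̄, A} be an exact interpolation problem on a strip of n triangles, and let {△̄, A}ₖᵐ be a subproblem with 1 ≤ k ≤ m ≤ n. If the subproblem {△̄, A}ₖᵐ is exact and not poised, or is overdetermined, then the problem {△̄, A} is not poised. -/
open scoped Classical

noncomputable section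

/-- The vertices `V k, …, V (m+2)` belong to the strip `|△̄ₖᵐ|`. -/
theorem vertex_mem_stripSet (V : ℕ → E) {k m j : ℕ} (hkm : k ≤ m) (hj : j < m - k + 3) :
    V (k + j) ∈ stripSet V k m := by
  have key : ∀ i, k ≤ i → i ≤ m → tri V i ⊆ stripSet V k m := fun i hi hi' =>
    Set.subset_biUnion_of_mem (u := tri V) (Finset.mem_Icc.2 ⟨hi, hi'⟩)
  by_cases hjm : k + j ≤ m
  · exact key (k + j) (by omega) hjm (subset_convexHull ℝ _ (by simp))
  · obtain h | h : k + j = m + 1 ∨ k + j = m + 2 := by omega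
    all_goals
      rw [h]
      exact key m hkm le_rfl (subset_convexHull ℝ _ (by simp))

/-- Evaluation of the functions in `S(△̄ₖᵐ)` at a family of points of the strip. -/
def stripEval (V : ℕ → E) (k m : ℕ) {ι : Type*} (p : ι → stripSet V k m) :
    stripSpace V k m →ₗ[ℝ] (ι → ℝ) :=
  (LinearMap.funLeft ℝ ℝ p).comp (stripSpace V k m).subtype

@[simp]
theorem stripEval_apply (V : ℕ → E) (k m : ℕ) {ι : Type*} (p : ι → stripSet V k m)
    (s : stripSpace V k m) (i : ι) : stripEval V k m p s i = s.1 (p i) := rfl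

/-- A function in `S(△̄ₖᵐ)` is determined by its values at the vertices. -/
theorem stripEval_vertices_injective (V : ℕ → E) {k m : ℕ} (hkm : k ≤ m) :
    Function.Injective (stripEval V k m fun j : Fin (m - k + 3) =>
      ⟨V (k + j), vertex_mem_stripSet V hkm j.2⟩) := by
  rw [injective_iff_map_eq_zero]
  intro s hs
  have hvert : ∀ (i : ℕ) (hi : V i ∈ stripSet V k m), k ≤ i → i ≤ m + 2 →
      s.1 ⟨V i, hi⟩ = 0 := by
    intro i hi h1 h2
    have := congrFun hs ⟨i - k, by omega⟩
    simpa [Nat.add_sub_cancel' h1] using this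
  ext ⟨x, hx⟩
  obtain ⟨i, hi, hxi⟩ := Set.mem_iUnion₂.1 hx
  obtain ⟨f, hf⟩ := s.2.2 i hi
  obtain ⟨hki, him⟩ := Finset.mem_Icc.1 hi
  have hsub : tri V i ⊆ stripSet V k m := Set.subset_biUnion_of_mem (u := tri V) hi
  have hzero : ∀ y ∈ ({V i, V (i + 1), V (i + 2)} : Set E), f y = 0 := by
    intro y hy
    have hyt : y ∈ tri V i := subset_convexHull ℝ _ hy
    rw [← hf ⟨y, hsub hyt⟩ hyt]
    rcases hy with rfl | rfl | rfl <;> exact hvert _ _ (by omega) (by omega)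
  have hconv : tri V i ⊆ f ⁻¹' {0} :=
    convexHull_min hzero ((convex_singleton (𝕜 := ℝ) (0 : ℝ)).affine_preimage f)
  exact (hf ⟨x, hx⟩ hxi).trans (hconv hxi)

theorem finiteDimensional_stripSpace (V : ℕ → E) {k m : ℕ} (hkm : k ≤ m) :
    FiniteDimensional ℝ (stripSpace V k m) :=
  FiniteDimensional.of_injective _ (stripEval_vertices_injective V hkm)

theorem finrank_stripSpace_le (V : ℕ → E) {k m : ℕ} (hkm : k ≤ m) :
    Module.finrank ℝ (stripSpace V k m) ≤ m - k + 3 := by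
  simpa using LinearMap.finrank_le_finrank_of_injective (stripEval_vertices_injective V hkm)

theorem stripSet_mono (V : ℕ → E) {k m k' m' : ℕ} (hk : k' ≤ k) (hm : m ≤ m') :
    stripSet V k m ⊆ stripSet V k' m' :=
  Set.biUnion_subset_biUnion_left fun _ hi => Finset.Icc_subset_Icc hk hm hi

/-- The restriction of a function in `S(△̄)` to a substrip. -/
theorem comp_inclusion_mem_stripSpace (V : ℕ → E) {k m k' m' : ℕ} (hk : k' ≤ k) (hm : m ≤ m')
    {s : stripSet V k' m' → ℝ} (hs : s ∈ stripSpace V k' m') :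
    s ∘ Set.inclusion (stripSet_mono V hk hm) ∈ stripSpace V k m := by
  refine ⟨hs.1.comp (continuous_inclusion _), fun i hi => ?_⟩
  obtain ⟨f, hf⟩ := hs.2 i (Finset.Icc_subset_Icc hk hm hi)
  exact ⟨f, fun x hx => hf (Set.inclusion _ x) hx⟩

/-- If every data on `B` can be interpolated in `S(△̄ₖᵐ)`, then `B` has at most `m - k + 3`
elements, and in the case of equality `B` is poised. -/
theorem card_le_and_poised_of_exists_interpolant (V : ℕ → E) {k m : ℕ} (hkm : k ≤ m)
    {B : Finset E} (hB : ∀ b ∈ B, b ∈ stripSet V k m)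
    (hex : ∀ c : E → ℝ, ∃ s ∈ stripSpace V k m,
      ∀ b : stripSet V k m, (b : E) ∈ B → s b = c b) :
    B.card ≤ m - k + 3 ∧ (B.card = m - k + 3 → Poised V k m B) := by
  have := finiteDimensional_stripSpace V hkm
  have hle := finrank_stripSpace_le V hkm
  let ev := stripEval V k m fun b : B => ⟨b, hB b b.2⟩
  have hsurj : Function.Surjective ev := by
    intro g
    obtain ⟨s, hs, hsB⟩ := hex fun x => if hx : x ∈ B then g ⟨x, hx⟩ else 0
    refine ⟨⟨s, hs⟩, ?_⟩
    ext b
    simpa [ev] using hsB ⟨b, hB b b.2⟩ b.2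
  have hge : B.card ≤ Module.finrank ℝ (stripSpace V k m) := by
    simpa using LinearMap.finrank_le_finrank_of_surjective hsurj
  refine ⟨hge.trans hle, fun hcard c => ?_⟩
  have hinj : Function.Injective ev :=
    (LinearMap.injective_iff_surjective_of_finrank_eq_finrank (by simp; omega)).2 hsurj
  obtain ⟨s, hs, hsB⟩ := hex c
  refine ⟨s, ⟨hs, hsB⟩, fun t ⟨ht, htB⟩ => ?_⟩
  have hev : ev ⟨t, ht⟩ = ev ⟨s, hs⟩ := by
    ext b
    exact (htB ⟨b, hB b b.2⟩ b.2).trans (hsB ⟨b, hB b b.2⟩ b.2).symm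
  exact congrArg Subtype.val (hinj hev)

/-- If the subproblem `{△̄, A}ₖᵐ` of an exact problem `{△̄, A}`
is exact and not poised, or is overdetermined, then `{△̄, A}` is not
poised. -/
theorem not_poised_of_subproblem (n k m : ℕ) (hn : 1 ≤ n) (V : ℕ → E)
    (hV : IsStrip n V) (A : Finset E) (hA : ↑A ⊆ stripSet V 1 n)
    (hexact : A.card = n + 2) (hk : 1 ≤ k) (hkm : k ≤ m) (hm : m ≤ n)
    (h : ((nodesIn V k m A).card = m - k + 3 ∧
            ¬ Poised V k m (nodesIn V k m A)) ∨
         m - k + 3 < (nodesIn V k m A).card) :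
    ¬ Poised V 1 n A := by
  intro hP
  have hex : ∀ c : E → ℝ, ∃ s ∈ stripSpace V k m,
      ∀ b : stripSet V k m, (b : E) ∈ nodesIn V k m A → s b = c b := by
    intro c
    obtain ⟨s, ⟨hs, hsA⟩, -⟩ := hP c
    exact ⟨_, comp_inclusion_mem_stripSpace V hk hm hs,
      fun b hb => hsA (Set.inclusion _ b) (Finset.mem_filter.1 hb).1⟩
  obtain ⟨hle, hpoised⟩ := card_le_and_poised_of_exists_interpolant V hkm
    (fun b hb => (Finset.mem_filter.1 hb).2) hex
  rcases h with ⟨hcard, hnot⟩ | hlt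
  · exact hnot (hpoised hcard)
  · exact absurd hlt hle.not_gt
end
end
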